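/- If the pair (U,V) of bounded linear operators on H satisfies the symplectic relations and Z is a transposition-symmetric bounded operator with ‖Z‖ < 1, then with Z̃ := ζ(U,V; Z) one has the identity 1 − Z̃ Z̃* = (U* + Z V*)⁻¹ (1 − Z Z*) ((U* + Z V*)⁻¹)*, and consequently ‖Z̃‖ < 1. -/

import Mathlib

open ContinuousLinearMap
open scoped InnerProductSpace

variable {H : Type*} [NormedAddCommGroup H] [InnerProductSpace ℂ H] [CompleteSpace H]

/-- The complex conjugate `Ā := J ∘ A ∘ J` of a bounded operator with respect to the
conjugation `J`. -/
noncomputable def conjOp (J : H →L⋆[ℂ] H) (A : H →L[ℂ] H) : H →L[ℂ] H :=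
  (J.comp A).comp J

/-- The transpose `Aᵀ := J ∘ A* ∘ J` of a bounded operator with respect to the
conjugation `J`. -/
noncomputable def transp (J : H →L⋆[ℂ] H) (A : H →L[ℂ] H) : H →L[ℂ] H :=
  conjOp J (adjoint A)

/-- The pair `(U, V)` satisfies the symplectic relations:
`U U* − V V* = 1`, `U Vᵀ = V Uᵀ`, `U* U − Vᵀ V̄ = 1`, `Uᵀ V̄ = V* U`. -/
def SymplecticPair (J : H →L⋆[ℂ] H) (U V : H →L[ℂ] H) : Prop :=
  U ∘L adjoint U - V ∘L adjoint V = 1 ∧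
  U ∘L transp J V = V ∘L transp J U ∧
  adjoint U ∘L U - transp J V ∘L conjOp J V = 1 ∧
  transp J U ∘L conjOp J V = adjoint V ∘L U

/-- The Siegel-disc action `ζ(U,V; Z) := (U* + Z V*)⁻¹ (Vᵀ + Z Uᵀ)`. -/
noncomputable def zeta (J : H →L⋆[ℂ] H) (U V Z : H →L[ℂ] H) : H →L[ℂ] H :=
  Ring.inverse (adjoint U + Z ∘L adjoint V) ∘L (transp J V + Z ∘L transp J U)

/-- A norm-preserving conjugate-linear map reverses the inner product. -/
theorem inner_conj_conj (J : H →L⋆[ℂ] H) (hJnorm : ∀ x, ‖J x‖ = ‖x‖) (x y : H) :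
    ⟪J x, J y⟫_ℂ = ⟪y, x⟫_ℂ := by
  rw [inner_eq_sum_norm_sq_div_four, inner_eq_sum_norm_sq_div_four]
  have h₁ : ‖J x + J y‖ = ‖y + x‖ := by rw [← map_add, hJnorm, add_comm]
  have h₂ : ‖J x - J y‖ = ‖y - x‖ := by rw [← map_sub, hJnorm, norm_sub_rev]
  have h₃ : ‖J x - Complex.I • J y‖ = ‖y - Complex.I • x‖ := by
    have : J x - Complex.I • J y = J (Complex.I • (y - Complex.I • x)) := by
      simp [smul_smul, sub_eq_add_neg, add_comm]
    rw [this, hJnorm, norm_smul]; simp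
  have h₄ : ‖J x + Complex.I • J y‖ = ‖y + Complex.I • x‖ := by
    have : J x + Complex.I • J y = J (-(Complex.I • (y + Complex.I • x))) := by
      simp [smul_add, smul_smul]
    rw [this, hJnorm, norm_neg, norm_smul]; simp
  simp [h₁, h₂, h₃, h₄]

theorem conjOp_mul (J : H →L⋆[ℂ] H) (hJinv : ∀ x, J (J x) = x) (A B : H →L[ℂ] H) :
    conjOp J (A * B) = conjOp J A * conjOp J B := by
  ext x; simp [conjOp, hJinv]

theorem conjOp_sub (J : H →L⋆[ℂ] H) (A B : H →L[ℂ] H) :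
    conjOp J (A - B) = conjOp J A - conjOp J B := by
  ext x; simp [conjOp]

theorem conjOp_one (J : H →L⋆[ℂ] H) (hJinv : ∀ x, J (J x) = x) :
    conjOp J (1 : H →L[ℂ] H) = 1 := by
  ext x; simp [conjOp, hJinv]

theorem conjOp_conjOp (J : H →L⋆[ℂ] H) (hJinv : ∀ x, J (J x) = x) (A : H →L[ℂ] H) :
    conjOp J (conjOp J A) = A := by
  ext x; simp [conjOp, hJinv]

theorem star_conjOp (J : H →L⋆[ℂ] H) (hJinv : ∀ x, J (J x) = x) (hJnorm : ∀ x, ‖J x‖ = ‖x‖)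
    (A : H →L[ℂ] H) : star (conjOp J A) = transp J A := by
  rw [star_eq_adjoint, eq_comm, eq_adjoint_iff]
  intro x y
  have h₁ := inner_conj_conj J hJnorm (adjoint A (J x)) (J y)
  have h₂ := inner_conj_conj J hJnorm (A (J y)) (J x)
  rw [hJinv] at h₁ h₂
  simp only [transp, conjOp, comp_apply]
  rw [h₁, adjoint_inner_right, ← inner_conj_symm, ← h₂, inner_conj_symm]

theorem star_transp (J : H →L⋆[ℂ] H) (hJinv : ∀ x, J (J x) = x) (hJnorm : ∀ x, ‖J x‖ = ‖x‖)
    (A : H →L[ℂ] H) : star (transp J A) = conjOp J A := by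
  rw [← star_conjOp J hJinv hJnorm, star_star]

/-- The numerator and denominator of the Siegel-disc action satisfy
`A A* − B B* = 1 − Z Z*`. -/
theorem SymplecticPair.mul_star_sub_mul_star {J : H →L⋆[ℂ] H} (hJinv : ∀ x, J (J x) = x)
    (hJnorm : ∀ x, ‖J x‖ = ‖x‖) {U V : H →L[ℂ] H} (h : SymplecticPair J U V) (Z : H →L[ℂ] H) :
    (star U + Z * star V) * star (star U + Z * star V)
      - (transp J V + Z * transp J U) * star (transp J V + Z * transp J U)
      = 1 - Z * star Z := by
  obtain ⟨-, -, h₃, h₄⟩ := h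
  change star U * U - transp J V * conjOp J V = 1 at h₃
  change transp J U * conjOp J V = star V * U at h₄
  have h₅ : transp J V * conjOp J U = star U * V := by
    have := congrArg star h₄
    simpa [star_transp J hJinv hJnorm, star_conjOp J hJinv hJnorm] using this
  have h₆ : transp J U * conjOp J U - star V * V = 1 := by
    have := congrArg (conjOp J) h₃
    rwa [conjOp_sub, conjOp_mul J hJinv, conjOp_mul J hJinv, conjOp_one J hJinv, transp,
      conjOp_conjOp J hJinv, conjOp_conjOp J hJinv] at this
  simp only [star_add, star_mul, star_star, star_transp J hJinv hJnorm]
  calc _ = (star U * U - transp J V * conjOp J V)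
        + (star U * V - transp J V * conjOp J U) * star Z
        + Z * (star V * U - transp J U * conjOp J V)
        - Z * (transp J U * conjOp J U - star V * V) * star Z := by noncomm_ring
    _ = _ := by rw [h₃, h₄, h₅, h₆]; noncomm_ring

/-- A bounded operator that is bounded below together with its adjoint is invertible. -/
theorem isUnit_of_bounded_below_of_adjoint {A : H →L[ℂ] H} {c d : ℝ} (hc : 0 < c) (hd : 0 < d)
    (hA : ∀ x, c * ‖x‖ ≤ ‖A x‖) (hA' : ∀ x, d * ‖x‖ ≤ ‖adjoint A x‖) : IsUnit A := by
  rw [isUnit_iff_bijective, bijective_iff_dense_range_and_antilipschitz]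
  constructor
  · rw [Submodule.topologicalClosure_eq_top_iff, orthogonal_range, LinearMap.ker_eq_bot']
    intro x hx
    have := hA' x
    have hx' : adjoint A x = 0 := hx
    rw [hx', norm_zero] at this
    exact norm_le_zero_iff.mp (by nlinarith)
  · refine ⟨⟨c⁻¹, by positivity⟩, A.antilipschitz_of_bound fun x => ?_⟩
    change ‖x‖ ≤ c⁻¹ * ‖A x‖
    rw [le_inv_mul_iff₀ hc]
    exact hA x

theorem norm_sq_apply_adjoint (A : H →L[ℂ] H) (x : H) :
    RCLike.re ⟪(A * star A) x, x⟫_ℂ = ‖adjoint A x‖ ^ 2 := by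
  have := apply_norm_sq_eq_inner_adjoint_left (adjoint A) x
  rw [adjoint_adjoint] at this
  exact this.symm

theorem norm_sq_sub_norm_sq_of_mul_star_sub_mul_star {A B C D : H →L[ℂ] H}
    (h : A * star A - B * star B = C * star C - D * star D) (x : H) :
    ‖adjoint A x‖ ^ 2 - ‖adjoint B x‖ ^ 2 = ‖adjoint C x‖ ^ 2 - ‖adjoint D x‖ ^ 2 := by
  have key := congrArg (fun T : H →L[ℂ] H => RCLike.re ⟪T x, x⟫_ℂ) h
  simpa only [sub_apply, inner_sub_left, map_sub, norm_sq_apply_adjoint] using key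

theorem SymplecticPair.norm_sq_sub_norm_sq {J : H →L⋆[ℂ] H} (hJinv : ∀ x, J (J x) = x)
    (hJnorm : ∀ x, ‖J x‖ = ‖x‖) {U V : H →L[ℂ] H} (h : SymplecticPair J U V) (Z : H →L[ℂ] H)
    (x : H) :
    ‖adjoint (star U + Z * star V) x‖ ^ 2 - ‖adjoint (transp J V + Z * transp J U) x‖ ^ 2
      = ‖x‖ ^ 2 - ‖adjoint Z x‖ ^ 2 := by
  have := norm_sq_sub_norm_sq_of_mul_star_sub_mul_star (C := 1) (D := Z)
    ((h.mul_star_sub_mul_star hJinv hJnorm Z).trans (by simp)) x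
  rwa [← star_eq_adjoint 1, star_one, one_apply_eq_self] at this

theorem norm_adjoint_apply_le (Z : H →L[ℂ] H) (x : H) : ‖adjoint Z x‖ ≤ ‖Z‖ * ‖x‖ := by
  simpa using (adjoint Z).le_opNorm x

/-- The denominator `U* + Z V*` of the Siegel-disc action is invertible. -/
theorem SymplecticPair.isUnit_denominator {J : H →L⋆[ℂ] H} (hJinv : ∀ x, J (J x) = x)
    (hJnorm : ∀ x, ‖J x‖ = ‖x‖) {U V : H →L[ℂ] H} (h : SymplecticPair J U V) {Z : H →L[ℂ] H}
    (hZ : ‖Z‖ < 1) : IsUnit (star U + Z * star V) := by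
  refine isUnit_of_bounded_below_of_adjoint (sub_pos.2 hZ) (sub_pos.2 hZ) (fun x => ?_)
    fun x => ?_
  · have h₁ : U * star U - V * star V = 1 := h.1
    have key := norm_sq_sub_norm_sq_of_mul_star_sub_mul_star (C := 1) (D := 0)
      (h₁.trans (by simp)) x
    rw [← star_eq_adjoint 1, star_one, one_apply_eq_self, map_zero, zero_apply, norm_zero] at key
    have hV : ‖adjoint V x‖ ≤ ‖adjoint U x‖ :=
      le_of_sq_le_sq (by nlinarith [sq_nonneg ‖x‖]) (norm_nonneg _)
    have hU : ‖x‖ ≤ ‖adjoint U x‖ :=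
      le_of_sq_le_sq (by nlinarith [sq_nonneg ‖adjoint V x‖]) (norm_nonneg _)
    have hZV : ‖Z (adjoint V x)‖ ≤ ‖Z‖ * ‖adjoint U x‖ := Z.le_opNorm_of_le hV
    calc (1 - ‖Z‖) * ‖x‖ ≤ (1 - ‖Z‖) * ‖adjoint U x‖ := by
          gcongr
      _ ≤ ‖adjoint U x‖ - ‖Z (adjoint V x)‖ := by linarith
      _ ≤ ‖adjoint U x + Z (adjoint V x)‖ := norm_sub_le_norm_add _ _
  · have key := h.norm_sq_sub_norm_sq hJinv hJnorm Z x
    refine le_of_sq_le_sq ?_ (norm_nonneg _)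
    have hZx : ‖adjoint Z x‖ ^ 2 ≤ (‖Z‖ * ‖x‖) ^ 2 := by
      gcongr
      exact norm_adjoint_apply_le Z x
    have : 0 ≤ ‖Z‖ * (1 - ‖Z‖) * ‖x‖ ^ 2 := by
      have := (sub_pos.2 hZ).le
      positivity
    nlinarith [sq_nonneg ‖adjoint (transp J V + Z * transp J U) x‖]

/-- If `A` is invertible and `‖A* y‖² − ‖B* y‖² ≥ c ‖y‖²` for some `c > 0`, then `A⁻¹ B` is a
strict contraction. -/
theorem norm_inverse_mul_lt_one {A B : H →L[ℂ] H} (hA : IsUnit A) {c : ℝ} (hc : 0 < c)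
    (h : ∀ y, c * ‖y‖ ^ 2 ≤ ‖adjoint A y‖ ^ 2 - ‖adjoint B y‖ ^ 2) :
    ‖Ring.inverse A * B‖ < 1 := by
  set k : ℝ := c / (‖A‖ ^ 2 + 1)
  have hk : 0 < k := by positivity
  have hkc : k * (‖A‖ ^ 2 + 1) = c := div_mul_cancel₀ _ (by positivity)
  rw [← norm_star]
  refine lt_of_le_of_lt (opNorm_le_bound _ (Real.sqrt_nonneg (1 - k)) fun x => ?_)
    ((Real.sqrt_lt' one_pos).2 (by linarith))
  set y := star (Ring.inverse A) x
  have hx : adjoint A y = x := by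
    have : star A * star (Ring.inverse A) = 1 := by
      rw [← star_mul, Ring.inverse_mul_cancel A hA, star_one]
    exact congrArg (fun T : H →L[ℂ] H => T x) this
  have hBy : star (Ring.inverse A * B) x = adjoint B y := by
    rw [star_mul]; rfl
  have hAy : ‖x‖ ^ 2 ≤ (‖A‖ * ‖y‖) ^ 2 := by
    gcongr
    simpa only [hx] using norm_adjoint_apply_le A y
  have hy' := h y
  rw [hx] at hy'
  have hbound : ‖adjoint B y‖ ^ 2 ≤ (1 - k) * ‖x‖ ^ 2 := by
    have h₁ : k * ‖x‖ ^ 2 ≤ k * (‖A‖ * ‖y‖) ^ 2 := by gcongr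
    have h₂ : c * ‖y‖ ^ 2 = k * (‖A‖ * ‖y‖) ^ 2 + k * ‖y‖ ^ 2 := by rw [← hkc]; ring
    have h₃ : 0 ≤ k * ‖y‖ ^ 2 := by positivity
    linarith
  rw [hBy, ← Real.sqrt_sq (norm_nonneg x), ← Real.sqrt_mul' _ (sq_nonneg _)]
  exact Real.le_sqrt_of_sq_le hbound

/-- With `Z̃ := ζ(U,V; Z)` one has
`1 − Z̃ Z̃* = (U* + Z V*)⁻¹ (1 − Z Z*) ((U* + Z V*)⁻¹)*`, and consequently `‖Z̃‖ < 1`. -/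
theorem statement10 (J : H →L⋆[ℂ] H) (hJinv : ∀ x, J (J x) = x) (hJnorm : ∀ x, ‖J x‖ = ‖x‖)
    (U V : H →L[ℂ] H) (h : SymplecticPair J U V)
    (Z : H →L[ℂ] H) (hZsym : Z = transp J Z) (hZ : ‖Z‖ < 1) :
    1 - zeta J U V Z ∘L adjoint (zeta J U V Z)
      = Ring.inverse (adjoint U + Z ∘L adjoint V) ∘L (1 - Z ∘L adjoint Z)
          ∘L adjoint (Ring.inverse (adjoint U + Z ∘L adjoint V)) ∧
    ‖zeta J U V Z‖ < 1 := by
  have hA : IsUnit (star U + Z * star V) := h.isUnit_denominator hJinv hJnorm hZ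
  constructor
  · change 1 - (Ring.inverse (star U + Z * star V) * (transp J V + Z * transp J U))
        * star (Ring.inverse (star U + Z * star V) * (transp J V + Z * transp J U))
      = Ring.inverse (star U + Z * star V) * ((1 - Z * star Z)
        * star (Ring.inverse (star U + Z * star V)))
    rw [← h.mul_star_sub_mul_star hJinv hJnorm Z]
    set A := star U + Z * star V
    set B := transp J V + Z * transp J U
    have hinv : Ring.inverse A * A = 1 := Ring.inverse_mul_cancel A hA
    have hinv' : star A * star (Ring.inverse A) = 1 := by rw [← star_mul, hinv, star_one]
    calc _ = (Ring.inverse A * A) * (star A * star (Ring.inverse A))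
          - (Ring.inverse A * B) * star (Ring.inverse A * B) := by rw [hinv, hinv', one_mul]
      _ = _ := by rw [star_mul]; noncomm_ring
  · refine norm_inverse_mul_lt_one hA (c := 1 - ‖Z‖ ^ 2) (by nlinarith [norm_nonneg Z])
      fun y => ?_
    refine le_of_le_of_eq ?_ (h.norm_sq_sub_norm_sq hJinv hJnorm Z y).symm
    have : ‖adjoint Z y‖ ^ 2 ≤ (‖Z‖ * ‖y‖) ^ 2 := by
      gcongr
      exact norm_adjoint_apply_le Z y
    linarith [mul_pow ‖Z‖ ‖y‖ 2]
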